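/- arXiv:0809.3845 — 2 statements merged into one kernel-verified Lean document; each statement's English description precedes it below -/
import Mathlib

section
/- For every real number N > 0 and every a ∈ ℝ, there exists a unique function u ∈ C²([0,∞)) satisfying u''(r) + u'(r)/r + (1+r²)^N e^{2u(r)} = 0 for all r ∈ (0,∞), u(0) = a, lim_{r→0⁺} u'(r) = 0, and ∫₀^∞ (1+r²)^N e^{2u(r)} r dr < ∞. -/
open Real Set MeasureTheory Filter

noncomputable section

/-- `u` is a solution of `u'' + u'/r + (1+r²)^N e^{2u} = 0` on `(0,∞)`, of class
`C²` on `[0,∞)`, with `u(0) = a`, `lim_{r→0⁺} u'(r) = 0` and finite mass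
`∫₀^∞ (1+r²)^N e^{2u} r dr < ∞`. -/
def IsSol0 (N a : ℝ) (u : ℝ → ℝ) : Prop :=
  ContDiffOn ℝ 2 u (Ici 0) ∧
  (∀ r : ℝ, 0 < r →
    deriv (deriv u) r + deriv u r / r + (1 + r ^ 2) ^ N * Real.exp (2 * u r) = 0) ∧
  u 0 = a ∧
  Tendsto (deriv u) (nhdsWithin 0 (Ioi 0)) (nhds 0) ∧
  IntegrableOn (fun r => (1 + r ^ 2) ^ N * Real.exp (2 * u r) * r) (Ioi 0)

/-- The weighted mean `∫₀¹ σ g(tσ) dσ`, equal to `t⁻² ∫₀ᵗ s g(s) ds` for `t ≠ 0`. -/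
def radialMean (g : ℝ → ℝ) (t : ℝ) : ℝ := ∫ σ in (0 : ℝ)..1, σ * g (t * σ)

/-- The solution `U` of `U'' + U'/r = g` with `U(0) = U'(0) = 0`. -/
def radialPotential (g : ℝ → ℝ) (r : ℝ) : ℝ := ∫ t in (0 : ℝ)..r, t * radialMean g t

lemma continuous_radialMean {g : ℝ → ℝ} (hg : Continuous g) : Continuous (radialMean g) := by
  unfold radialMean
  apply intervalIntegral.continuous_parametric_intervalIntegral_of_continuous'
  fun_prop

lemma sq_mul_radialMean (g : ℝ → ℝ) (t : ℝ) :
    t ^ 2 * radialMean g t = ∫ s in (0 : ℝ)..t, s * g s := by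
  have h := intervalIntegral.mul_integral_comp_mul_left (a := 0) (b := 1)
    (f := fun s => s * g s) t
  simp only [mul_zero, mul_one] at h
  rw [← h, radialMean, pow_two, mul_assoc, ← intervalIntegral.integral_const_mul t]
  simp only [mul_assoc]

lemma hasDerivAt_sq_mul_radialMean {g : ℝ → ℝ} (hg : Continuous g) (r : ℝ) :
    HasDerivAt (fun t => t ^ 2 * radialMean g t) (r * g r) r := by
  simp only [sq_mul_radialMean]
  have hc : Continuous fun s => s * g s := by fun_prop
  exact (hc.integral_hasStrictDerivAt 0 r).hasDerivAt

lemma hasDerivAt_radialPotential {g : ℝ → ℝ} (hg : Continuous g) (r : ℝ) :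
    HasDerivAt (radialPotential g) (r * radialMean g r) r := by
  have hc : Continuous fun s => s * radialMean g s :=
    continuous_id.mul (continuous_radialMean hg)
  exact (hc.integral_hasStrictDerivAt 0 r).hasDerivAt

lemma continuous_radialPotential {g : ℝ → ℝ} (hg : Continuous g) :
    Continuous (radialPotential g) :=
  continuous_iff_continuousAt.2 fun r => (hasDerivAt_radialPotential hg r).continuousAt

lemma hasDerivAt_mul_radialMean {g : ℝ → ℝ} (hg : Continuous g) (r : ℝ) :
    HasDerivAt (fun t => t * radialMean g t) (g r - radialMean g r) r := by
  rcases eq_or_ne r 0 with rfl | hr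
  · have h0 : g 0 - radialMean g 0 = radialMean g 0 := by
      simp only [radialMean, zero_mul, intervalIntegral.integral_mul_const, integral_id]
      ring
    rw [h0, hasDerivAt_iff_tendsto_slope]
    refine ((continuous_radialMean hg).tendsto 0 |>.mono_left nhdsWithin_le_nhds).congr' ?_
    filter_upwards [self_mem_nhdsWithin] with t ht
    have ht : t ≠ 0 := ht
    simp [slope, ht]
  · have h := (hasDerivAt_sq_mul_radialMean hg r).div (hasDerivAt_id r) hr
    refine (h.congr_of_eventuallyEq ?_).congr_deriv ?_
    · filter_upwards [isOpen_ne.mem_nhds hr] with t ht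
      have ht : t ≠ 0 := ht
      simp only [Pi.div_apply, id]
      field_simp
    · simp only [id]
      field_simp

lemma contDiff_radialPotential {g : ℝ → ℝ} (hg : Continuous g) :
    ContDiff ℝ 2 (radialPotential g) := by
  have h1 : deriv (radialPotential g) = fun r => r * radialMean g r :=
    funext fun r => (hasDerivAt_radialPotential hg r).deriv
  have h2 : deriv (fun r => r * radialMean g r) = fun r => g r - radialMean g r :=
    funext fun r => (hasDerivAt_mul_radialMean hg r).deriv
  rw [show (2 : WithTop ℕ∞) = 1 + 1 by norm_num, contDiff_succ_iff_deriv]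
  refine ⟨fun r => (hasDerivAt_radialPotential hg r).differentiableAt, by simp, ?_⟩
  rw [h1, contDiff_one_iff_deriv, h2]
  exact ⟨fun r => (hasDerivAt_mul_radialMean hg r).differentiableAt,
    hg.sub (continuous_radialMean hg)⟩

lemma radialMean_sub {f g : ℝ → ℝ} (hf : Continuous f) (hg : Continuous g) (t : ℝ) :
    radialMean (fun s => f s - g s) t = radialMean f t - radialMean g t := by
  simp only [radialMean, mul_sub]
  apply intervalIntegral.integral_sub <;> apply Continuous.intervalIntegrable <;> fun_prop

lemma radialPotential_sub {f g : ℝ → ℝ} (hf : Continuous f) (hg : Continuous g) (r : ℝ) :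
    radialPotential (fun s => f s - g s) r = radialPotential f r - radialPotential g r := by
  simp only [radialPotential, radialMean_sub hf hg, mul_sub]
  have := continuous_radialMean hf
  have := continuous_radialMean hg
  apply intervalIntegral.integral_sub <;> apply Continuous.intervalIntegrable <;> fun_prop

lemma radialMean_nonneg {g : ℝ → ℝ} (hg : ∀ s, 0 ≤ g s) (t : ℝ) : 0 ≤ radialMean g t :=
  intervalIntegral.integral_nonneg zero_le_one fun _ hσ => mul_nonneg hσ.1 (hg _)

lemma abs_radialMean_le {g B : ℝ → ℝ} (hB : MonotoneOn B (Ici 0)) (hg : ∀ s, 0 ≤ s → |g s| ≤ B s)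
    {t : ℝ} (ht : 0 ≤ t) : |radialMean g t| ≤ B t := by
  have h := intervalIntegral.norm_integral_le_of_norm_le_const (a := 0) (b := 1) (C := B t)
    (f := fun σ => σ * g (t * σ)) ?_
  · simpa [radialMean] using h
  · intro σ hσ
    rw [uIoc_of_le zero_le_one] at hσ
    have h0 : 0 ≤ t * σ := mul_nonneg ht hσ.1.le
    rw [norm_mul, Real.norm_eq_abs, Real.norm_eq_abs, abs_of_pos hσ.1]
    calc σ * |g (t * σ)| ≤ 1 * |g (t * σ)| := by gcongr; exact hσ.2
      _ = |g (t * σ)| := one_mul _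
      _ ≤ B (t * σ) := hg _ h0
      _ ≤ B t := hB h0 ht (mul_le_of_le_one_right ht hσ.2)

/-- A weight with respect to which the integral equation becomes a contraction. -/
def liouvilleWeight (N L t : ℝ) : ℝ := exp (L * (1 + t ^ 2) ^ (N + 1) / (N + 1))

lemma continuous_one_add_sq_rpow (N : ℝ) : Continuous fun t : ℝ => (1 + t ^ 2) ^ N :=
  Continuous.rpow_const (by fun_prop) fun t => Or.inl (by positivity)

lemma hasDerivAt_one_add_sq_rpow (N t : ℝ) :
    HasDerivAt (fun t : ℝ => (1 + t ^ 2) ^ N) (2 * N * t * (1 + t ^ 2) ^ (N - 1)) t := by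
  have h : HasDerivAt (fun t : ℝ => 1 + t ^ 2) (2 * t) t := by
    simpa using (hasDerivAt_pow 2 t).const_add 1
  exact (h.rpow_const (Or.inl (by positivity))).congr_deriv (by ring)

lemma continuous_liouvilleWeight (N L : ℝ) : Continuous (liouvilleWeight N L) := by
  have := continuous_one_add_sq_rpow (N + 1)
  unfold liouvilleWeight
  fun_prop

lemma hasDerivAt_liouvilleWeight {N : ℝ} (hN : 0 < N) (L t : ℝ) :
    HasDerivAt (liouvilleWeight N L)
      (2 * L * (t * ((1 + t ^ 2) ^ N * liouvilleWeight N L t))) t := by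
  have h := (((hasDerivAt_one_add_sq_rpow (N + 1) t).const_mul L).div_const (N + 1)).exp
  refine h.congr_deriv ?_
  rw [add_sub_cancel_right, liouvilleWeight]
  field_simp

lemma one_le_liouvilleWeight {N L : ℝ} (hN : 0 < N) (hL : 0 ≤ L) (t : ℝ) :
    1 ≤ liouvilleWeight N L t := by
  rw [liouvilleWeight, Real.one_le_exp_iff]
  positivity

lemma monotoneOn_liouvilleWeight {N L : ℝ} (hN : 0 < N) (hL : 0 ≤ L) :
    MonotoneOn (fun t => (1 + t ^ 2) ^ N * liouvilleWeight N L t) (Ici 0) := by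
  intro s hs t ht hst
  have hs : 0 ≤ s := hs
  simp only [liouvilleWeight]
  gcongr

lemma abs_radialPotential_le {N L C : ℝ} (hN : 0 < N) (hL : 0 < L) (hC : 0 ≤ C) {g : ℝ → ℝ}
    (hg : ∀ s, 0 ≤ s → |g s| ≤ C * L * ((1 + s ^ 2) ^ N * liouvilleWeight N L s))
    {r : ℝ} (hr : 0 ≤ r) : |radialPotential g r| ≤ C / 2 * liouvilleWeight N L r := by
  have hcW := continuous_liouvilleWeight N L
  have hcK := continuous_one_add_sq_rpow N
  have hd : ∀ t, HasDerivAt (fun t => C / 2 * liouvilleWeight N L t)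
      (t * (C * L * ((1 + t ^ 2) ^ N * liouvilleWeight N L t))) t := fun t =>
    ((hasDerivAt_liouvilleWeight hN L t).const_mul (C / 2)).congr_deriv (by ring)
  have hint : IntervalIntegrable
      (fun t => t * (C * L * ((1 + t ^ 2) ^ N * liouvilleWeight N L t))) volume 0 r :=
    Continuous.intervalIntegrable (by fun_prop) _ _
  have hmon : MonotoneOn (fun t => C * L * ((1 + t ^ 2) ^ N * liouvilleWeight N L t)) (Ici 0) :=
    fun s hs t ht hst => mul_le_mul_of_nonneg_left
      (monotoneOn_liouvilleWeight hN hL.le hs ht hst) (by positivity)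
  have h : ‖radialPotential g r‖ ≤
      ∫ t in (0 : ℝ)..r, t * (C * L * ((1 + t ^ 2) ^ N * liouvilleWeight N L t)) := by
    refine intervalIntegral.norm_integral_le_of_norm_le hr (ae_of_all _ fun t ht => ?_) hint
    rw [norm_mul, Real.norm_eq_abs, Real.norm_eq_abs, abs_of_pos ht.1]
    exact mul_le_mul_of_nonneg_left (abs_radialMean_le hmon hg ht.1.le) ht.1.le
  rw [intervalIntegral.integral_eq_sub_of_hasDerivAt (fun t _ => hd t) hint,
    Real.norm_eq_abs] at h
  have := one_le_liouvilleWeight hN hL.le 0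
  nlinarith

/-- The nonlinearity `e^{2x}`, truncated above the level `a`. -/
def truncExp (a x : ℝ) : ℝ := exp (2 * min x a)

lemma continuous_truncExp (a : ℝ) : Continuous (truncExp a) := by
  unfold truncExp
  fun_prop

lemma truncExp_le (a x : ℝ) : truncExp a x ≤ exp (2 * a) := by
  unfold truncExp
  gcongr
  exact min_le_right _ _

lemma abs_exp_sub_exp_le {b x y : ℝ} (hx : x ≤ b) (hy : y ≤ b) :
    |exp (2 * x) - exp (2 * y)| ≤ 2 * exp (2 * b) * |x - y| := by
  have h := (convex_Iic b).norm_image_sub_le_of_norm_hasDerivWithin_le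
    (f := fun x => exp (2 * x)) (f' := fun x => exp (2 * x) * 2) (C := 2 * exp (2 * b))
    (fun z _ => by
      simpa using ((hasDerivAt_id z).const_mul 2).exp.hasDerivWithinAt)
    (fun z hz => by
      have hz : z ≤ b := hz
      rw [Real.norm_eq_abs, abs_of_pos (by positivity), mul_comm]
      gcongr) hy hx
  simpa using h

lemma abs_truncExp_sub_le (a x y : ℝ) :
    |truncExp a x - truncExp a y| ≤ 2 * exp (2 * a) * |x - y| := by
  refine (abs_exp_sub_exp_le (min_le_right x a) (min_le_right y a)).trans ?_
  exact mul_le_mul_of_nonneg_left (abs_inf_sub_inf_le_abs x y a) (by positivity)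

lemma exists_truncated_fixedPoint {N : ℝ} (hN : 0 < N) (a : ℝ) :
    ∃ u : ℝ → ℝ, Continuous u ∧ ∀ r, 0 ≤ r →
      u r = a - radialPotential (fun s => (1 + s ^ 2) ^ N * truncExp a (u s)) r := by
  set L : ℝ := 2 * exp (2 * a) with hLdef
  have hL : 0 < L := by positivity
  set W := liouvilleWeight N L with hWdef
  have hW : Continuous W := continuous_liouvilleWeight N L
  have hW1 : ∀ t, 1 ≤ W t := one_le_liouvilleWeight hN hL.le
  have hW0 : ∀ t, 0 < W t := fun t => one_pos.trans_le (hW1 t)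
  have hWabs : ∀ t, W |t| = W t := fun t => by simp [hWdef, liouvilleWeight]
  have hK := continuous_one_add_sq_rpow N
  have hF := continuous_truncExp a
  let G : BoundedContinuousFunction ℝ ℝ → ℝ → ℝ := fun w s =>
    (1 + s ^ 2) ^ N * truncExp a (a + W s * w s)
  have hG : ∀ w, Continuous (G w) := fun w =>
    hK.mul (hF.comp (continuous_const.add (hW.mul w.continuous)))
  have hGle : ∀ w s, |G w s| ≤ 1 * L * ((1 + s ^ 2) ^ N * W s) := by
    intro w s
    have hp : 0 ≤ truncExp a (a + W s * w s) := (exp_pos _).le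
    have h2 : truncExp a (a + W s * w s) ≤ L * W s := by
      have := truncExp_le a (a + W s * w s)
      nlinarith [hW1 s, exp_pos (2 * a)]
    rw [abs_of_nonneg (by positivity)]
    calc G w s ≤ (1 + s ^ 2) ^ N * (L * W s) := by
          simp only [G]; gcongr
      _ = _ := by ring
  let S : BoundedContinuousFunction ℝ ℝ → BoundedContinuousFunction ℝ ℝ := fun w =>
    BoundedContinuousFunction.ofNormedAddCommGroup
      (fun r => -radialPotential (G w) |r| / W r)
      (((continuous_radialPotential (hG w)).comp continuous_abs).neg.div hW
        fun r => (hW0 r).ne') (1 / 2) (by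
      intro r
      have h := abs_radialPotential_le hN hL zero_le_one (fun s _ => hGle w s)
        (abs_nonneg r)
      rw [← hWdef, hWabs] at h
      rwa [norm_div, norm_neg, Real.norm_eq_abs, Real.norm_eq_abs, abs_of_pos (hW0 r),
        div_le_iff₀ (hW0 r)])
  have hS : ContractingWith (1 / 2) S := by
    refine ⟨by
      rw [← NNReal.coe_lt_coe]
      norm_num, LipschitzWith.of_dist_le_mul fun w v => ?_⟩
    rw [BoundedContinuousFunction.dist_le (by positivity)]
    intro r
    have hd : ∀ s, 0 ≤ s → |G w s - G v s| ≤ dist w v * L * ((1 + s ^ 2) ^ N * W s) := by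
      intro s _
      have h1 := abs_truncExp_sub_le a (a + W s * w s) (a + W s * v s)
      rw [add_sub_add_left_eq_sub, ← mul_sub, abs_mul, abs_of_pos (hW0 s)] at h1
      have h2 : |w s - v s| ≤ dist w v :=
        BoundedContinuousFunction.dist_coe_le_dist (f := w) (g := v) s
      simp only [G]
      rw [← mul_sub, abs_mul, abs_of_nonneg (by positivity : (0 : ℝ) ≤ (1 + s ^ 2) ^ N)]
      calc _ ≤ (1 + s ^ 2) ^ N * (L * (W s * dist w v)) := by
            gcongr
            refine h1.trans ?_
            have := (hW0 s).le
            gcongr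
        _ = _ := by ring
    have h := abs_radialPotential_le hN hL dist_nonneg
      (g := fun s => G w s - G v s) hd (abs_nonneg r)
    rw [radialPotential_sub (hG w) (hG v), ← hWdef, hWabs] at h
    change |-radialPotential (G w) |r| / W r - -radialPotential (G v) |r| / W r| ≤ _
    rw [← sub_div, neg_sub_neg, abs_div, abs_of_pos (hW0 r), div_le_iff₀ (hW0 r), abs_sub_comm]
    refine h.trans (le_of_eq ?_)
    push_cast
    ring
  let w := hS.fixedPoint S
  have hw : S w = w := hS.fixedPoint_isFixedPt
  refine ⟨fun r => a + W r * w r, continuous_const.add (hW.mul w.continuous), fun r hr => ?_⟩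
  have h : -radialPotential (G w) |r| / W r = w r := DFunLike.congr_fun hw r
  rw [abs_of_nonneg hr] at h
  change a + W r * w r = a - radialPotential (G w) r
  rw [← h, mul_div_cancel₀ _ (hW0 r).ne', sub_eq_add_neg]

/-- The Pohozaev-type bound `∫₀ʳ s (1+s²)^N e^{2u} ds ≤ 2N + 2`. -/
lemma mass_le {N : ℝ} (hN : 0 < N) {u g : ℝ → ℝ} (hg : Continuous g)
    (hu : ∀ r, HasDerivAt u (-(r * radialMean g r)) r)
    (hug : ∀ r, 0 ≤ r → g r = (1 + r ^ 2) ^ N * exp (2 * u r)) (hg0 : ∀ r, 0 ≤ g r)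
    {r : ℝ} (hr : 0 ≤ r) : r ^ 2 * radialMean g r ≤ 2 * N + 2 := by
  set m : ℝ → ℝ := fun t => t ^ 2 * radialMean g t with hm
  have hmd : ∀ t, HasDerivAt m (t * g t) t := hasDerivAt_sq_mul_radialMean hg
  let Q : ℝ → ℝ := fun t =>
    (2 * N + 2) * m t - m t ^ 2 - t ^ 2 * ((1 + t ^ 2) ^ N * exp (2 * u t))
  have hQd : ∀ t, HasDerivAt Q ((2 * N + 2) * (t * g t) - 2 * m t * (t * g t)
      - (2 * t * ((1 + t ^ 2) ^ N * exp (2 * u t)) + t ^ 2 *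
        (2 * N * t * (1 + t ^ 2) ^ (N - 1) * exp (2 * u t) + (1 + t ^ 2) ^ N *
          (exp (2 * u t) * (2 * -(t * radialMean g t)))))) t := by
    intro t
    have h1 := (hasDerivAt_one_add_sq_rpow N t).mul ((hu t).const_mul 2).exp
    have h2 := (hasDerivAt_pow 2 t).mul h1
    have h3 := (((hmd t).const_mul (2 * N + 2)).sub ((hmd t).pow 2)).sub h2
    exact h3.congr_deriv (by norm_num)
  have hmono : MonotoneOn Q (Ici 0) := by
    refine monotoneOn_of_deriv_nonneg (convex_Ici 0)
      (fun t _ => (hQd t).continuousAt.continuousWithinAt)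
      (fun t _ => (hQd t).differentiableAt.differentiableWithinAt) fun t ht => ?_
    rw [interior_Ici] at ht
    have ht : 0 < t := ht
    rw [(hQd t).deriv, hug t ht.le]
    have hp : (0 : ℝ) < 1 + t ^ 2 := by positivity
    have hK : (1 + t ^ 2) ^ N = (1 + t ^ 2) ^ (N - 1) * (1 + t ^ 2) := by
      rw [Real.rpow_sub_one hp.ne']
      field_simp
    have hpos : 0 ≤ 2 * N * t * ((1 + t ^ 2) ^ (N - 1) * exp (2 * u t)) := by positivity
    refine hpos.trans (le_of_eq ?_)
    rw [hK, hm]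
    ring
  have h0 : Q 0 = 0 := by simp [Q, hm]
  have hQ : 0 ≤ Q r := h0 ▸ hmono self_mem_Ici hr hr
  have hm0 : 0 ≤ m r := mul_nonneg (sq_nonneg r) (radialMean_nonneg hg0 r)
  have hP : 0 ≤ r ^ 2 * ((1 + r ^ 2) ^ N * exp (2 * u r)) := by positivity
  change m r ≤ _
  by_contra! hlt
  have : 0 < m r * (m r - (2 * N + 2)) := mul_pos (by linarith) (by linarith)
  simp only [Q] at hQ
  nlinarith

lemma exists_isSol0 {N : ℝ} (hN : 0 < N) (a : ℝ) : ∃ u, IsSol0 N a u := by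
  obtain ⟨v, hv, hfix⟩ := exists_truncated_fixedPoint hN a
  set g : ℝ → ℝ := fun s => (1 + s ^ 2) ^ N * truncExp a (v s) with hgdef
  have hg : Continuous g := (continuous_one_add_sq_rpow N).mul ((continuous_truncExp a).comp hv)
  have hg0 : ∀ s, 0 ≤ g s := fun s =>
    mul_nonneg (by positivity) (exp_pos _).le
  set u : ℝ → ℝ := fun r => a - radialPotential g r with hudef
  have hu : ∀ r, HasDerivAt u (-(r * radialMean g r)) r := fun r =>
    (hasDerivAt_radialPotential hg r).const_sub a
  have hle : ∀ r, 0 ≤ r → u r ≤ a := fun r hr =>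
    sub_le_self _ (intervalIntegral.integral_nonneg hr fun t ht =>
      mul_nonneg ht.1 (radialMean_nonneg hg0 t))
  have hug : ∀ r, 0 ≤ r → g r = (1 + r ^ 2) ^ N * exp (2 * u r) := by
    intro r hr
    have hvu : v r = u r := hfix r hr
    rw [hgdef]
    simp only [truncExp, hvu, min_eq_left (hle r hr)]
  have hd : deriv u = fun r => -(r * radialMean g r) := funext fun r => (hu r).deriv
  refine ⟨u, (contDiff_const.sub (contDiff_radialPotential hg)).contDiffOn, fun r hr => ?_,
    by simp [hudef, radialPotential], ?_, ?_⟩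
  · rw [hd, (hasDerivAt_mul_radialMean hg r).fun_neg.deriv, ← hug r hr.le]
    field_simp
    ring
  · rw [hd]
    have hc : Continuous fun r => -(r * radialMean g r) :=
      (continuous_id.mul (continuous_radialMean hg)).neg
    simpa using (hc.tendsto 0).mono_left (nhdsWithin_le_nhds (s := Ioi 0))
  · have hc : Continuous fun s => s * g s := by fun_prop
    have h : IntegrableOn (fun s => s * g s) (Ioi 0) := by
      refine integrableOn_Ioi_of_intervalIntegral_norm_bounded (2 * N + 2) 0
        (fun r => (hc.integrableOn_Icc).mono_set Ioc_subset_Icc_self) tendsto_id ?_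
      filter_upwards [eventually_ge_atTop 0] with r hr
      refine le_trans (le_of_eq ?_) (mass_le hN hg hu hug hg0 hr)
      rw [sq_mul_radialMean]
      refine intervalIntegral.integral_congr fun s hs => ?_
      rw [id, uIcc_of_le hr] at hs
      exact Real.norm_of_nonneg (mul_nonneg hs.1 (hg0 s))
    refine h.congr_fun (fun s hs => ?_) measurableSet_Ioi
    have hs : 0 < s := hs
    simp only [hug s hs.le]
    ring

lemma IsSol0.hasDerivAt {N a : ℝ} {u : ℝ → ℝ} (hu : IsSol0 N a u) {r : ℝ} (hr : 0 < r) :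
    HasDerivAt u (deriv u r) r :=
  ((hu.1.contDiffAt (Ici_mem_nhds hr)).differentiableAt (by norm_num)).hasDerivAt

lemma IsSol0.hasDerivAt_deriv {N a : ℝ} {u : ℝ → ℝ} (hu : IsSol0 N a u) {r : ℝ} (hr : 0 < r) :
    HasDerivAt (deriv u) (-(deriv u r / r) - (1 + r ^ 2) ^ N * exp (2 * u r)) r := by
  have hc : ContDiffOn ℝ 2 u (Ioi 0) := hu.1.mono Ioi_subset_Ici_self
  have hc1 : ContDiffOn ℝ 1 (deriv u) (Ioi 0) := hc.deriv_of_isOpen isOpen_Ioi (by norm_num)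
  have h := ((hc1.contDiffAt (Ioi_mem_nhds hr)).differentiableAt (by norm_num)).hasDerivAt
  exact h.congr_deriv (by linarith [hu.2.1 r hr])

lemma IsSol0.tendsto {N a : ℝ} {u : ℝ → ℝ} (hu : IsSol0 N a u) :
    Tendsto u (nhdsWithin 0 (Ioi 0)) (nhds a) := by
  have h := (hu.1.continuousOn 0 self_mem_Ici).mono Ioi_subset_Ici_self
  rwa [ContinuousWithinAt, hu.2.2.1] at h

lemma IsSol0.eqOn {N a : ℝ} (hN : 0 < N) {u v : ℝ → ℝ} (hu : IsSol0 N a u) (hv : IsSol0 N a v) :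
    EqOn v u (Ici 0) := by
  intro R hR
  rcases eq_or_lt_of_le (show (0 : ℝ) ≤ R from hR) with rfl | hR
  · rw [hu.2.2.1, hv.2.2.1]
  obtain ⟨b₁, hb₁⟩ := (isCompact_Icc.image_of_continuousOn
    (hu.1.continuousOn.mono (Icc_subset_Ici_self : Icc 0 R ⊆ Ici 0))).bddAbove
  obtain ⟨b₂, hb₂⟩ := (isCompact_Icc.image_of_continuousOn
    (hv.1.continuousOn.mono (Icc_subset_Ici_self : Icc 0 R ⊆ Ici 0))).bddAbove
  set b := max b₁ b₂
  have hub : ∀ r ∈ Icc 0 R, u r ≤ b := fun r hr =>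
    (hb₁ (mem_image_of_mem u hr)).trans (le_max_left _ _)
  have hvb : ∀ r ∈ Icc 0 R, v r ≤ b := fun r hr =>
    (hb₂ (mem_image_of_mem v hr)).trans (le_max_right _ _)
  set C : ℝ := 1 + (1 + R ^ 2) ^ N * (2 * exp (2 * b)) with hC
  let E : ℝ → ℝ := fun r => ((v r - u r) ^ 2 + (deriv v r - deriv u r) ^ 2) * exp (-C * r)
  have hEd : ∀ r, 0 < r → HasDerivAt E
      ((2 * (v r - u r) * (deriv v r - deriv u r) + 2 * (deriv v r - deriv u r) *
        (-(deriv v r / r) - (1 + r ^ 2) ^ N * exp (2 * v r)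
          - (-(deriv u r / r) - (1 + r ^ 2) ^ N * exp (2 * u r)))) * exp (-C * r)
        + ((v r - u r) ^ 2 + (deriv v r - deriv u r) ^ 2) * (exp (-C * r) * (-C))) r := by
    intro r hr
    have h1 := ((hv.hasDerivAt hr).sub (hu.hasDerivAt hr)).pow 2
    have h2 := ((hv.hasDerivAt_deriv hr).sub (hu.hasDerivAt_deriv hr)).pow 2
    have h3 := ((hasDerivAt_id r).const_mul (-C)).exp
    exact ((h1.add h2).mul h3).congr_deriv (by norm_num)
  have hanti : AntitoneOn E (Ioc 0 R) := by
    refine antitoneOn_of_deriv_nonpos (convex_Ioc 0 R)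
      (fun r hr => (hEd r hr.1).continuousAt.continuousWithinAt)
      (fun r hr => (hEd r (interior_subset hr).1).differentiableAt.differentiableWithinAt)
      fun r hr => ?_
    replace hr := interior_subset hr
    have hr0 := hr.1
    rw [(hEd r hr0).deriv]
    have hx := abs_exp_sub_exp_le (hvb r ⟨hr0.le, hr.2⟩) (hub r ⟨hr0.le, hr.2⟩)
    have hKR : (1 + r ^ 2) ^ N ≤ (1 + R ^ 2) ^ N := by
      gcongr
      exact hr.2
    set x := v r - u r
    set y := deriv v r - deriv u r with hy
    set D := exp (2 * v r) - exp (2 * u r) with hD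
    have hKD : |(1 + r ^ 2) ^ N * D| ≤ (C - 1) * |x| := by
      rw [abs_mul, abs_of_nonneg (by positivity : (0 : ℝ) ≤ (1 + r ^ 2) ^ N), hC,
        add_sub_cancel_left, mul_assoc]
      gcongr
    have hmain : 2 * x * y - 2 * y * ((1 + r ^ 2) ^ N * D) ≤ C * (x ^ 2 + y ^ 2) := by
      have hC1 : 0 ≤ C - 1 := by
        rw [hC, add_sub_cancel_left]
        positivity
      have h1 : -(y * ((1 + r ^ 2) ^ N * D)) ≤ |y| * ((C - 1) * |x|) := by
        refine (neg_le_abs _).trans ?_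
        rw [abs_mul]
        gcongr
      have h2 : 2 * (|y| * |x|) ≤ x ^ 2 + y ^ 2 := by
        nlinarith [sq_nonneg (|y| - |x|), sq_abs x, sq_abs y]
      nlinarith [sq_nonneg (x - y), mul_le_mul_of_nonneg_left h2 hC1]
    have hy2 : 0 ≤ y ^ 2 / r := by positivity
    have heq : (2 * x * y + 2 * y * (-(deriv v r / r) - (1 + r ^ 2) ^ N * exp (2 * v r)
          - (-(deriv u r / r) - (1 + r ^ 2) ^ N * exp (2 * u r)))) * exp (-C * r)
        + (x ^ 2 + y ^ 2) * (exp (-C * r) * (-C))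
        = (2 * x * y - 2 * y * ((1 + r ^ 2) ^ N * D) - C * (x ^ 2 + y ^ 2) - 2 * (y ^ 2 / r))
          * exp (-C * r) := by
      rw [hD, hy]
      ring
    rw [heq]
    exact mul_nonpos_of_nonpos_of_nonneg (by linarith) (exp_pos _).le
  have hlim : Tendsto E (nhdsWithin 0 (Ioi 0)) (nhds 0) := by
    have h3 : Tendsto (fun r => exp (-C * r)) (nhdsWithin 0 (Ioi 0)) (nhds (exp (-C * 0))) :=
      Tendsto.mono_left (Continuous.tendsto (by fun_prop) 0) nhdsWithin_le_nhds
    have h := (((hv.tendsto.sub hu.tendsto).pow 2).add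
      ((hv.2.2.2.1.sub hu.2.2.2.1).pow 2)).mul h3
    simpa [E] using h
  have hER : E R ≤ 0 := by
    refine ge_of_tendsto hlim ?_
    filter_upwards [Ioc_mem_nhdsGT hR] with r hr
    exact hanti hr ⟨hR, le_rfl⟩ hr.2
  have hsq : (v R - u R) ^ 2 + (deriv v R - deriv u R) ^ 2 ≤ 0 :=
    nonpos_of_mul_nonpos_left hER (exp_pos _)
  have : (v R - u R) ^ 2 = 0 :=
    le_antisymm (by linarith [sq_nonneg (deriv v R - deriv u R)]) (sq_nonneg _)
  exact sub_eq_zero.1 (pow_eq_zero_iff two_ne_zero |>.1 this)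

/-- For every `N > 0` and `a ∈ ℝ` there exists a unique (as a function on `[0,∞)`)
solution of the radial Liouville equation with `u(0) = a`, `u'(0⁺) = 0` and finite mass. -/
theorem existence_uniqueness_radial_solution (N : ℝ) (hN : 0 < N) (a : ℝ) :
    ∃ u : ℝ → ℝ, IsSol0 N a u ∧ ∀ v : ℝ → ℝ, IsSol0 N a v → EqOn v u (Ici 0) := by
  obtain ⟨u, hu⟩ := exists_isSol0 hN a
  exact ⟨u, hu, fun v hv => hu.eqOn hN hv⟩
end
end

section
/- For every real number N > 0 and every a ∈ ℝ, one has max{2, N+1} < α(a) < 2(N+1). -/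
open Real Set MeasureTheory Filter

noncomputable section

/-- `u` is a radial solution of the Liouville equation
`u'' + u'/r + (1+r²)^N e^{2u} = 0` on `(0,∞)`, of class `C²` on `[0,∞)`,
with `u'(0) = 0` and finite mass `∫₀^∞ (1+r²)^N e^{2u} r dr < ∞`. -/
def IsSol (N : ℝ) (u : ℝ → ℝ) : Prop :=
  ContDiffOn ℝ 2 u (Ici 0) ∧
  (∀ r : ℝ, 0 < r →
    deriv (deriv u) r + deriv u r / r + (1 + r ^ 2) ^ N * Real.exp (2 * u r) = 0) ∧
  derivWithin u (Ici 0) 0 = 0 ∧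
  IntegrableOn (fun r => (1 + r ^ 2) ^ N * Real.exp (2 * u r) * r) (Ioi 0)

/-- A function bounded below by `c / r` near infinity, with `c > 0`, is not integrable. -/
theorem not_integrableOn_of_le_mul {f : ℝ → ℝ} {c : ℝ} (hc : 0 < c)
    (h : ∀ r : ℝ, 1 < r → c ≤ r * f r) : ¬ IntegrableOn f (Ioi 0) := by
  intro hf
  have hf1 : IntegrableOn f (Ioi 1) := hf.mono_set (Ioi_subset_Ioi zero_le_one)
  refine not_integrableOn_Ioi_inv (a := 1) ?_
  refine Integrable.mono' (hf1.const_mul c⁻¹) measurable_inv.aestronglyMeasurable ?_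
  filter_upwards [ae_restrict_mem measurableSet_Ioi] with r hr
  have hr1 : (1 : ℝ) < r := hr
  have hr0 : 0 < r := by linarith
  rw [Real.norm_of_nonneg (inv_nonneg.2 hr0.le), ← one_div, div_le_iff₀ hr0, mul_assoc,
    ← div_eq_inv_mul, le_div_iff₀ hc, one_mul, mul_comm]
  exact h r hr1

namespace IsSol

variable {N : ℝ} {u : ℝ → ℝ}

/-- The mass density `(1+r²)^N e^{2u} r`. -/
def density (N : ℝ) (u : ℝ → ℝ) (r : ℝ) : ℝ := (1 + r ^ 2) ^ N * Real.exp (2 * u r) * r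

/-- The quantity `-r u'(r)`, which is the mass of the ball of radius `r`. -/
def flux (u : ℝ → ℝ) (r : ℝ) : ℝ := -(r * derivWithin u (Ici 0) r)

theorem density_pos {r : ℝ} (hr : 0 < r) : 0 < density N u r := by
  unfold density; positivity

theorem flux_zero : flux u 0 = 0 := by simp [flux]

theorem flux_eq {r : ℝ} (hr : 0 < r) : flux u r = -(r * deriv u r) := by
  rw [flux, derivWithin_of_mem_nhds (Ici_mem_nhds hr)]

theorem hasDerivAt (h : IsSol N u) {r : ℝ} (hr : 0 < r) : HasDerivAt u (-flux u r / r) r := by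
  have hd : DifferentiableAt ℝ u r :=
    (h.1.contDiffAt (Ici_mem_nhds hr)).differentiableAt (by norm_num)
  refine hd.hasDerivAt.congr_deriv ?_
  rw [flux_eq hr]
  field_simp

theorem continuousOn (h : IsSol N u) : ContinuousOn u (Ici 0) := h.1.continuousOn

theorem continuousOn_flux (h : IsSol N u) : ContinuousOn (flux u) (Ici 0) :=
  (continuousOn_id.mul
    (h.1.continuousOn_derivWithin (uniqueDiffOn_Ici 0) (by norm_num))).neg

theorem continuousOn_density (h : IsSol N u) : ContinuousOn (density N u) (Ici 0) := by
  have h1 : Continuous fun r : ℝ => (1 + r ^ 2) ^ N :=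
    (by fun_prop : Continuous fun r : ℝ => 1 + r ^ 2).rpow_const
      fun r => Or.inl (by positivity)
  exact (h1.continuousOn.mul (Real.continuous_exp.comp_continuousOn
    (continuousOn_const.mul h.continuousOn))).mul continuousOn_id

theorem hasDerivAt_flux (h : IsSol N u) {r : ℝ} (hr : 0 < r) :
    HasDerivAt (flux u) (density N u r) r := by
  have hd : DifferentiableAt ℝ (deriv u) r := by
    have h2 : ContDiffAt ℝ 2 u r := h.1.contDiffAt (Ici_mem_nhds hr)
    exact (h2.derivWithin (m := 1) (by norm_num)).differentiableAt (by norm_num)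
  have hmul := ((hasDerivAt_id r).mul hd.hasDerivAt).neg
  have heq : flux u =ᶠ[nhds r] -(id * deriv u) := by
    filter_upwards [Ioi_mem_nhds hr] with s hs
    simp [flux_eq hs]
  refine (hmul.congr_of_eventuallyEq heq).congr_deriv ?_
  have hode := h.2.1 r hr
  field_simp at hode
  simp only [density, id]
  linarith

/-- The density satisfies `(r f)' = f (2 + 2N r²/(1+r²) - 2 Φ)`, where `Φ` is the flux. -/
theorem hasDerivAt_mul_density (h : IsSol N u) {r : ℝ} (hr : 0 < r) :
    HasDerivAt (fun s => s * density N u s)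
      (density N u r * (2 + 2 * N * (r ^ 2 / (1 + r ^ 2)) - 2 * flux u r)) r := by
  have hpos : 0 < 1 + r ^ 2 := by positivity
  have h1 : HasDerivAt (fun s : ℝ => 1 + s ^ 2) (2 * r) r := by
    simpa using (hasDerivAt_pow 2 r).const_add 1
  have h2 := h1.rpow_const (p := N) (Or.inl hpos.ne')
  have h3 := ((h.hasDerivAt hr).const_mul 2).exp
  have h4 := (hasDerivAt_id r).mul ((h2.mul h3).mul (hasDerivAt_id r))
  refine h4.congr_deriv ?_
  rw [Real.rpow_sub_one hpos.ne']
  simp only [density, id, Pi.mul_apply]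
  field_simp
  ring

theorem strictMonoOn_flux (h : IsSol N u) : StrictMonoOn (flux u) (Ici 0) := by
  refine strictMonoOn_of_deriv_pos (convex_Ici 0) h.continuousOn_flux fun r hr => ?_
  rw [interior_Ici] at hr
  rw [(h.hasDerivAt_flux hr).deriv]
  exact density_pos hr

theorem tendsto_flux (h : IsSol N u) :
    Tendsto (flux u) atTop (nhds (∫ r in Ioi (0 : ℝ), density N u r)) := by
  refine (intervalIntegral_tendsto_integral_Ioi 0 h.2.2.2 tendsto_id).congr' ?_
  filter_upwards [eventually_ge_atTop 0] with r hr
  have := intervalIntegral.integral_eq_sub_of_hasDerivAt_of_le hr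
    (h.continuousOn_flux.mono Icc_subset_Ici_self)
    (fun x hx => h.hasDerivAt_flux hx.1)
    ((h.continuousOn_density.mono
      ((uIcc_of_le hr).trans_subset Icc_subset_Ici_self)).intervalIntegrable)
  rw [flux_zero, sub_zero] at this
  exact this

theorem flux_le (h : IsSol N u) {r : ℝ} (hr : 0 ≤ r) :
    flux u r ≤ ∫ r in Ioi (0 : ℝ), density N u r := by
  refine ge_of_tendsto h.tendsto_flux ?_
  filter_upwards [eventually_ge_atTop r] with s hs
  exact h.strictMonoOn_flux.monotoneOn hr (hr.trans hs) hs

theorem flux_nonneg (h : IsSol N u) {r : ℝ} (hr : 0 ≤ r) : 0 ≤ flux u r := by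
  rw [← flux_zero (u := u)]
  exact h.strictMonoOn_flux.monotoneOn self_mem_Ici hr hr

/-- Local Pohozaev identity in differentiated form. -/
theorem hasDerivAt_pohozaev (h : IsSol N u) (k : ℝ) {r : ℝ} (hr : 0 < r) :
    HasDerivAt (fun s => flux u s ^ 2 + s * density N u s - k * flux u s)
      (density N u r * (2 + 2 * N * (r ^ 2 / (1 + r ^ 2)) - k)) r := by
  refine ((((h.hasDerivAt_flux hr).pow 2).add (h.hasDerivAt_mul_density hr)).sub
    ((h.hasDerivAt_flux hr).const_mul k)).congr_deriv ?_
  norm_num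
  ring

theorem continuousOn_pohozaev (h : IsSol N u) (k : ℝ) :
    ContinuousOn (fun s => flux u s ^ 2 + s * density N u s - k * flux u s) (Ici 0) :=
  ((h.continuousOn_flux.pow 2).add (continuousOn_id.mul h.continuousOn_density)).sub
    (continuousOn_const.mul h.continuousOn_flux)

theorem two_lt_mass (hN : 0 < N) (h : IsSol N u) :
    2 < ∫ r in Ioi (0 : ℝ), density N u r := by
  by_contra! hle
  have hmono := strictMonoOn_of_deriv_pos (convex_Ici 0) (h.continuousOn_pohozaev 2)
    (fun r hr => by
      rw [interior_Ici] at hr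
      have hr0 : 0 < r := hr
      rw [(h.hasDerivAt_pohozaev 2 hr).deriv]
      refine mul_pos (density_pos hr) ?_
      have : 0 < 2 * N * (r ^ 2 / (1 + r ^ 2)) := by positivity
      linarith)
  have hc := hmono self_mem_Ici (zero_le_one (α := ℝ)) zero_lt_one
  simp only [flux_zero] at hc
  norm_num at hc
  refine not_integrableOn_of_le_mul (sub_pos.2 hc) (fun r hr => ?_) h.2.2.2
  have hr0 : 0 ≤ r := by linarith
  have h1 := hmono (zero_le_one (α := ℝ)) hr0 hr
  have h2 := h.flux_nonneg hr0
  have h3 := (h.flux_le hr0).trans hle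
  simp only [one_mul] at h1
  change _ ≤ r * density N u r
  nlinarith

theorem mass_lt (hN : 0 < N) (h : IsSol N u) :
    ∫ r in Ioi (0 : ℝ), density N u r < 2 * (N + 1) := by
  have hanti := strictAntiOn_of_deriv_neg (convex_Ici 0)
    (h.continuousOn_pohozaev (2 * (N + 1))) (fun r hr => by
      rw [interior_Ici] at hr
      rw [(h.hasDerivAt_pohozaev _ hr).deriv]
      refine mul_neg_of_pos_of_neg (density_pos hr) ?_
      have : r ^ 2 / (1 + r ^ 2) < 1 := by
        rw [div_lt_one (by positivity)]
        linarith
      nlinarith)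
  have hc := hanti self_mem_Ici (zero_le_one (α := ℝ)) zero_lt_one
  simp only [flux_zero] at hc
  norm_num at hc
  have hlim := (h.tendsto_flux.pow 2).sub (h.tendsto_flux.const_mul (2 * (N + 1)))
  have hle := le_of_tendsto hlim (b := flux u 1 ^ 2 + density N u 1 - 2 * (N + 1) * flux u 1) (by
    filter_upwards [eventually_gt_atTop 1] with r hr
    have hr0 : 0 < r := by linarith
    have h1 := hanti (zero_le_one (α := ℝ)) hr0.le hr
    have h2 := mul_pos hr0 (density_pos (N := N) (u := u) hr0)
    simp only [one_mul] at h1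
    linarith)
  have hpos := two_lt_mass hN h
  nlinarith

theorem add_one_lt_mass (hN : 0 < N) (h : IsSol N u) :
    N + 1 < ∫ r in Ioi (0 : ℝ), density N u r := by
  by_contra! hle
  have hd : ∀ r : ℝ, 0 < r → HasDerivAt (fun s => u s + (N + 1) * Real.log s)
      (-flux u r / r + (N + 1) * r⁻¹) r := fun r hr =>
    (h.hasDerivAt hr).add ((Real.hasDerivAt_log hr.ne').const_mul (N + 1))
  have hmono : MonotoneOn (fun s => u s + (N + 1) * Real.log s) (Ici 1) := by
    refine monotoneOn_of_deriv_nonneg (convex_Ici 1)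
      (fun r hr => (hd r (zero_lt_one.trans_le hr)).continuousAt.continuousWithinAt)
      (fun r hr => ?_) (fun r hr => ?_)
    all_goals
      rw [interior_Ici] at hr
      have hr0 : 0 < r := zero_lt_one.trans hr
    · exact (hd r hr0).differentiableAt.differentiableWithinAt
    · rw [(hd r hr0).deriv, div_eq_mul_inv, ← add_mul]
      have := (h.flux_le hr0.le).trans hle
      exact mul_nonneg (by linarith) (inv_nonneg.2 hr0.le)
  refine not_integrableOn_of_le_mul (Real.exp_pos (2 * u 1)) (fun r hr => ?_) h.2.2.2
  have hr0 : 0 < r := by linarith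
  have h1 := hmono self_mem_Ici hr.le hr.le
  simp only [Real.log_one, mul_zero, add_zero] at h1
  have hrN : Real.exp (2 * N * Real.log r) ≤ (1 + r ^ 2) ^ N := by
    calc Real.exp (2 * N * Real.log r) = (r ^ 2) ^ N := by
          rw [Real.rpow_def_of_pos (by positivity), Real.log_pow]
          push_cast
          ring_nf
      _ ≤ (1 + r ^ 2) ^ N := by
          gcongr
          linarith
  calc Real.exp (2 * u 1)
      ≤ Real.exp (2 * N * Real.log r + 2 * u r + Real.log r + Real.log r) :=
        Real.exp_le_exp.2 (by linarith)
    _ = r * (Real.exp (2 * N * Real.log r) * Real.exp (2 * u r) * r) := by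
        rw [Real.exp_add, Real.exp_add, Real.exp_add, Real.exp_log hr0]
        ring
    _ ≤ r * ((1 + r ^ 2) ^ N * Real.exp (2 * u r) * r) := by gcongr

end IsSol

/-- For every `N > 0` and every `a ∈ ℝ`, `max{2, N+1} < α(a) < 2(N+1)`. -/
theorem alpha_bounds (N : ℝ) (hN : 0 < N)
    (u : ℝ → ℝ → ℝ) (hu : ∀ a : ℝ, IsSol N (u a) ∧ u a 0 = a)
    (α : ℝ → ℝ)
    (hα : ∀ a : ℝ, α a = ∫ r in Ioi (0:ℝ), (1 + r ^ 2) ^ N * Real.exp (2 * u a r) * r)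
    (a : ℝ) :
    max 2 (N + 1) < α a ∧ α a < 2 * (N + 1) := by
  obtain ⟨h, -⟩ := hu a
  rw [hα a]
  exact ⟨max_lt (IsSol.two_lt_mass hN h) (IsSol.add_one_lt_mass hN h), IsSol.mass_lt hN h⟩
end
end
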